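/- arXiv:1903.11015 — 3 statements merged into one kernel-verified Lean document; each statement's English description precedes it below -/
import Mathlib

section
/- Fix θ ∈ ℝ. Then: (1) g_θ(δ) → 2 − 2cos θ as δ → 2⁺; (2) g_θ is strictly increasing on (2, ∞); (3) g_θ(δ) > 2 − 2cos θ for all δ > 2; and (4) g_θ(δ) → +∞ as δ → +∞. -/
/-- The function `g_θ(δ)`, defined for `δ > 2`. -/
noncomputable def gTheta (θ : ℝ) (δ : ℝ) : ℝ :=
  ((δ - 2 * Real.cos θ) / Real.sqrt (δ ^ 2 - 4)) *
    Real.log ((δ + Real.sqrt (δ ^ 2 - 4)) / (δ - Real.sqrt (δ ^ 2 - 4)))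

open Filter Topology Set

/-- The function `g_θ` in the variable `t = arcosh (δ / 2)`, with `c = cos θ`. -/
noncomputable def hyperbolicQuotient (c t : ℝ) : ℝ :=
  2 * t * (Real.cosh t - c) / Real.sinh t

theorem gTheta_two_mul_cosh (θ : ℝ) {t : ℝ} (ht : 0 < t) :
    gTheta θ (2 * Real.cosh t) = hyperbolicQuotient (Real.cos θ) t := by
  have hS : 0 < Real.sinh t := Real.sinh_pos_iff.2 ht
  have hsqrt : Real.sqrt ((2 * Real.cosh t) ^ 2 - 4) = 2 * Real.sinh t := by
    rw [show (2 * Real.cosh t) ^ 2 - 4 = (2 * Real.sinh t) ^ 2 by rw [mul_pow, Real.cosh_sq]; ring]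
    exact Real.sqrt_sq (by positivity)
  have hquot : (2 * Real.cosh t + 2 * Real.sinh t) / (2 * Real.cosh t - 2 * Real.sinh t)
      = Real.exp (2 * t) := by
    rw [← mul_add, ← mul_sub, Real.cosh_add_sinh, Real.cosh_sub_sinh,
      mul_div_mul_left _ _ two_ne_zero, ← Real.exp_sub]
    ring_nf
  rw [gTheta, hyperbolicQuotient, hsqrt, hquot, Real.log_exp]
  field_simp

theorem gTheta_eq_hyperbolicQuotient (θ : ℝ) {δ : ℝ} (hδ : 2 < δ) :
    gTheta θ δ = hyperbolicQuotient (Real.cos θ) (Real.arcosh (δ / 2)) := by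
  rw [← gTheta_two_mul_cosh θ (Real.arcosh_pos (by linarith)), Real.cosh_arcosh (by linarith)]
  ring_nf

theorem hasDerivAt_hyperbolicQuotient (c : ℝ) {t : ℝ} (ht : t ≠ 0) :
    HasDerivAt (hyperbolicQuotient c)
      (2 * ((Real.cosh t - c) * Real.sinh t - t + t * c * Real.cosh t) / Real.sinh t ^ 2) t := by
  have hS : Real.sinh t ≠ 0 := Real.sinh_ne_zero.2 ht
  have h := ((((hasDerivAt_id t).const_mul 2).mul ((Real.hasDerivAt_cosh t).sub_const c)).div
    (Real.hasDerivAt_sinh t) hS)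
  refine h.congr_deriv ?_
  simp only [id, Pi.mul_apply]
  congr 1
  linear_combination (-2 * t) * Real.cosh_sq t

theorem strictMonoOn_hyperbolicQuotient {c : ℝ} (hc₁ : -1 ≤ c) (hc₂ : c ≤ 1) :
    StrictMonoOn (hyperbolicQuotient c) (Ioi 0) := by
  refine strictMonoOn_of_deriv_pos (convex_Ioi 0)
    (fun t ht => (hasDerivAt_hyperbolicQuotient c (ne_of_gt ht)).continuousAt.continuousWithinAt)
    fun t ht => ?_
  rw [interior_Ioi, mem_Ioi] at ht
  rw [(hasDerivAt_hyperbolicQuotient c ht.ne').deriv]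
  have hS : 0 < Real.sinh t := Real.sinh_pos_iff.2 ht
  have hC : 1 < Real.cosh t := Real.one_lt_cosh.2 ht.ne'
  have h₁ : 0 < (Real.cosh t - c) * (Real.sinh t - t) :=
    mul_pos (by linarith) (sub_pos.2 (Real.self_lt_sinh_iff.2 ht))
  have h₂ : 0 ≤ t * ((Real.cosh t - 1) * (1 + c)) :=
    mul_nonneg ht.le (mul_nonneg (by linarith) (by linarith))
  refine div_pos ?_ (by positivity)
  linarith

theorem tendsto_hyperbolicQuotient_zero (c : ℝ) :
    Tendsto (hyperbolicQuotient c) (𝓝[≠] 0) (𝓝 (2 - 2 * c)) := by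
  have h₁ : Tendsto (fun t : ℝ => (t⁻¹ * Real.sinh t)⁻¹) (𝓝[≠] 0) (𝓝 1) := by
    simpa using (Real.hasDerivAt_sinh 0).tendsto_slope_zero.inv₀ (by simp)
  have h₂ : Tendsto (fun t : ℝ => 2 * (Real.cosh t - c)) (𝓝[≠] 0) (𝓝 (2 - 2 * c)) := by
    have : Continuous fun t : ℝ => 2 * (Real.cosh t - c) := by fun_prop
    have h := this.tendsto 0
    rw [Real.cosh_zero, mul_sub, mul_one] at h
    exact h.mono_left nhdsWithin_le_nhds
  have h := h₂.mul h₁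
  rw [mul_one] at h
  refine h.congr fun t => ?_
  rw [hyperbolicQuotient, mul_inv, inv_inv]
  ring

theorem le_hyperbolicQuotient {c t : ℝ} (hc : c ≤ 1) (ht : 0 < t) (hC : 2 ≤ Real.cosh t) :
    t ≤ hyperbolicQuotient c t := by
  have hS : 0 < Real.sinh t := Real.sinh_pos_iff.2 ht
  rw [hyperbolicQuotient, le_div_iff₀ hS]
  nlinarith [Real.sinh_lt_cosh t]

theorem tendsto_arcosh_atTop : Tendsto Real.arcosh atTop atTop := by
  refine tendsto_atTop_mono' _ ?_ Real.tendsto_log_atTop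
  filter_upwards [eventually_gt_atTop 0] with x hx
  exact Real.log_le_log hx (le_add_of_nonneg_right (Real.sqrt_nonneg _))

theorem tendsto_gTheta_two (θ : ℝ) :
    Tendsto (gTheta θ) (𝓝[>] 2) (𝓝 (2 - 2 * Real.cos θ)) := by
  have harcosh : Tendsto (fun δ : ℝ => Real.arcosh (δ / 2)) (𝓝[>] 2) (𝓝[≠] 0) := by
    refine tendsto_nhdsWithin_iff.2 ⟨?_, ?_⟩
    · have hcont : ContinuousOn (fun δ : ℝ => Real.arcosh (δ / 2)) (Ici 2) :=
        Real.continuousOn_arcosh.comp (by fun_prop) fun δ (hδ : 2 ≤ δ) => by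
          rw [mem_Ici]; linarith
      have h := (hcont 2 self_mem_Ici).tendsto
      rw [div_self two_ne_zero, Real.arcosh_zero] at h
      exact h.mono_left (nhdsWithin_mono _ Ioi_subset_Ici_self)
    · filter_upwards [self_mem_nhdsWithin] with δ (hδ : 2 < δ)
      exact (Real.arcosh_pos (by linarith)).ne'
  refine ((tendsto_hyperbolicQuotient_zero (Real.cos θ)).comp harcosh).congr' ?_
  filter_upwards [self_mem_nhdsWithin] with δ hδ
  exact (gTheta_eq_hyperbolicQuotient θ hδ).symm

theorem strictMonoOn_gTheta (θ : ℝ) : StrictMonoOn (gTheta θ) (Ioi 2) := by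
  intro x (hx : 2 < x) y (hy : 2 < y) hxy
  rw [gTheta_eq_hyperbolicQuotient θ hx, gTheta_eq_hyperbolicQuotient θ hy]
  exact strictMonoOn_hyperbolicQuotient (Real.neg_one_le_cos θ) (Real.cos_le_one θ)
    (Real.arcosh_pos (by linarith)) (Real.arcosh_pos (by linarith))
    ((Real.arcosh_lt_arcosh (by linarith) (by linarith)).2 (by linarith))

theorem lt_gTheta (θ : ℝ) {δ : ℝ} (hδ : 2 < δ) : 2 - 2 * Real.cos θ < gTheta θ δ := by
  obtain ⟨m, hm, hmδ⟩ := exists_between hδ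
  refine lt_of_le_of_lt ?_ (strictMonoOn_gTheta θ hm hδ hmδ)
  refine le_of_tendsto (tendsto_gTheta_two θ) ?_
  filter_upwards [Ioo_mem_nhdsGT hm] with x hx
  exact (strictMonoOn_gTheta θ hx.1 hm hx.2).le

theorem tendsto_gTheta_atTop (θ : ℝ) : Tendsto (gTheta θ) atTop atTop := by
  refine tendsto_atTop_mono' _ ?_
    (tendsto_arcosh_atTop.comp (tendsto_id.atTop_div_const (zero_lt_two' ℝ)))
  filter_upwards [eventually_ge_atTop 4] with δ hδ
  rw [gTheta_eq_hyperbolicQuotient θ (by linarith), Function.comp_apply, id]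
  refine le_hyperbolicQuotient (Real.cos_le_one θ) (Real.arcosh_pos (by linarith)) ?_
  rw [Real.cosh_arcosh (by linarith)]
  linarith

theorem stmt14 (θ : ℝ) :
    -- (1) g_θ(δ) → 2 − 2cos θ as δ → 2⁺
    Filter.Tendsto (gTheta θ) (nhdsWithin 2 (Set.Ioi 2))
      (nhds (2 - 2 * Real.cos θ)) ∧
    -- (2) g_θ is strictly increasing on (2, ∞)
    StrictMonoOn (gTheta θ) (Set.Ioi 2) ∧
    -- (3) g_θ(δ) > 2 − 2cos θ for all δ > 2
    (∀ δ : ℝ, 2 < δ → 2 - 2 * Real.cos θ < gTheta θ δ) ∧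
    -- (4) g_θ(δ) → +∞ as δ → +∞
    Filter.Tendsto (gTheta θ) Filter.atTop Filter.atTop :=
  ⟨tendsto_gTheta_two θ, strictMonoOn_gTheta θ, fun _ hδ => lt_gTheta θ hδ,
    tendsto_gTheta_atTop θ⟩
end

section
/- For all r > 0 with r ≠ 1 and all θ ∈ ℝ: (1) 0 < h(r) < 1; (2) the denominator β(r)·cos θ + α(r) is strictly positive, so ω(r,θ) is well defined; (3) ω(1/r, θ) = ω(r, θ); (4) 1 − h(r) ≤ ω(r,θ) ≤ 1 + h(r), with equality on the left if and only if cos θ = −1 and equality on the right if and only if cos θ = 1; consequently 0 < ω(r,θ) < 2. -/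
/-- `h(r) = r·log(r²)/(r²−1)` for `r ≠ 1`, with `h(1) = 1`. -/
noncomputable def h (r : ℝ) : ℝ :=
  if r = 1 then 1 else r * Real.log (r ^ 2) / (r ^ 2 - 1)

/-- `α(r) = r² + 1 − 2r·h(r)`. -/
noncomputable def alph (r : ℝ) : ℝ := r ^ 2 + 1 - 2 * r * h r

/-- `β(r) = (r²+1)·h(r) − 2r`. -/
noncomputable def bet (r : ℝ) : ℝ := (r ^ 2 + 1) * h r - 2 * r

/-- `ω(r,θ) = 1 + h(r)·(α(r)cos θ + β(r))/(β(r)cos θ + α(r))`. -/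
noncomputable def omeg (r θ : ℝ) : ℝ :=
  1 + h r * (alph r * Real.cos θ + bet r) / (bet r * Real.cos θ + alph r)

theorem h_eq {r : ℝ} (hr1 : r ≠ 1) : h r = r * (2 * Real.log r) / (r ^ 2 - 1) := by
  rw [h, if_neg hr1, Real.log_pow]
  norm_num

theorem h_pos {r : ℝ} (hr : 0 < r) (hr1 : r ≠ 1) : 0 < h r := by
  rw [h_eq hr1]
  rcases lt_or_gt_of_ne hr1 with hlt | hgt
  · have hlog := Real.log_neg hr hlt
    exact div_pos_of_neg_of_neg (by nlinarith) (by nlinarith)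
  · have hlog := Real.log_pos hgt
    exact div_pos (by positivity) (by nlinarith)

theorem h_lt_one {r : ℝ} (hr : 0 < r) (hr1 : r ≠ 1) : h r < 1 := by
  have hsinh : r * (2 * Real.sinh (Real.log r)) = r ^ 2 - 1 := by
    rw [Real.sinh_log hr]
    field_simp
  rw [h_eq hr1]
  rcases lt_or_gt_of_ne hr1 with hlt | hgt
  · have hlog := Real.sinh_lt_self_iff.mpr (Real.log_neg hr hlt)
    rw [div_lt_one_of_neg (by nlinarith)]
    nlinarith
  · have hlog := Real.self_lt_sinh_iff.mpr (Real.log_pos hgt)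
    rw [div_lt_one (by nlinarith)]
    nlinarith

theorem h_one_div {r : ℝ} (hr : 0 < r) : h (1 / r) = h r := by
  by_cases hr1 : r = 1
  · simp [hr1]
  · have hinv : 1 / r ≠ 1 := by simpa using hr1
    have hden : r ^ 2 - 1 ≠ 0 := by
      intro h0
      exact hr1 (by nlinarith)
    have hden' : 1 - r ^ 2 ≠ 0 := fun h0 => hden (by linarith)
    rw [h_eq hinv, h_eq hr1, one_div, Real.log_inv]
    have hinvden : r⁻¹ ^ 2 - 1 = (1 - r ^ 2) / r ^ 2 := by field_simp
    rw [hinvden]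
    field_simp
    ring

theorem alph_one_div {r : ℝ} (hr : 0 < r) : alph (1 / r) = alph r / r ^ 2 := by
  rw [alph, alph, h_one_div hr]
  field_simp
  ring

theorem bet_one_div {r : ℝ} (hr : 0 < r) : bet (1 / r) = bet r / r ^ 2 := by
  rw [bet, bet, h_one_div hr]
  field_simp
  ring

theorem omeg_one_div {r : ℝ} (hr : 0 < r) (θ : ℝ) : omeg (1 / r) θ = omeg r θ := by
  have hr2 : r ^ 2 ≠ 0 := by positivity
  rw [omeg, omeg, h_one_div hr, alph_one_div hr, bet_one_div hr,
    ← mul_div_mul_right _ (bet r * Real.cos θ + alph r) hr2,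
    ← mul_div_mul_right _ (bet r / r ^ 2 * Real.cos θ + alph r / r ^ 2)
      (mul_ne_zero hr2 hr2)]
  congr 2 <;> field_simp

theorem alph_sub_bet_pos {r : ℝ} (hr : 0 < r) (hr1 : r ≠ 1) : 0 < alph r - bet r := by
  have heq : alph r - bet r = (r + 1) ^ 2 * (1 - h r) := by
    rw [alph, bet]
    ring
  rw [heq]
  exact mul_pos (by positivity) (sub_pos.mpr (h_lt_one hr hr1))

theorem alph_add_bet_pos {r : ℝ} (hr : 0 < r) (hr1 : r ≠ 1) : 0 < alph r + bet r := by
  have heq : alph r + bet r = (r - 1) ^ 2 * (1 + h r) := by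
    rw [alph, bet]
    ring
  rw [heq]
  have hh := h_pos hr hr1
  exact mul_pos (sq_pos_of_ne_zero (sub_ne_zero.mpr hr1)) (by linarith)

theorem denom_pos {r : ℝ} (hr : 0 < r) (hr1 : r ≠ 1) (θ : ℝ) :
    0 < bet r * Real.cos θ + alph r := by
  have hsub := alph_sub_bet_pos hr hr1
  have hadd := alph_add_bet_pos hr hr1
  have hc := Real.cos_le_one θ
  have hc' := Real.neg_one_le_cos θ
  rcases le_total 0 (bet r) with hb | hb <;> nlinarith

theorem omeg_sub_one_sub_h {r : ℝ} (hr : 0 < r) (hr1 : r ≠ 1) (θ : ℝ) :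
    omeg r θ - (1 - h r) =
      h r * (alph r + bet r) / (bet r * Real.cos θ + alph r) * (1 + Real.cos θ) := by
  have hd := (denom_pos hr hr1 θ).ne'
  have hcancel := div_mul_cancel₀ (h r * (alph r * Real.cos θ + bet r)) hd
  rw [omeg, div_mul_eq_mul_div, eq_div_iff hd]
  linear_combination hcancel

theorem one_add_h_sub_omeg {r : ℝ} (hr : 0 < r) (hr1 : r ≠ 1) (θ : ℝ) :
    1 + h r - omeg r θ =
      h r * (alph r - bet r) / (bet r * Real.cos θ + alph r) * (1 - Real.cos θ) := by
  have hd := (denom_pos hr hr1 θ).ne'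
  have hcancel := div_mul_cancel₀ (h r * (alph r * Real.cos θ + bet r)) hd
  rw [omeg, div_mul_eq_mul_div, eq_div_iff hd]
  linear_combination -hcancel

theorem stmt16 (r θ : ℝ) (hr : 0 < r) (hr1 : r ≠ 1) :
    -- (1)
    (0 < h r ∧ h r < 1) ∧
    -- (2)
    0 < bet r * Real.cos θ + alph r ∧
    -- (3)
    omeg (1 / r) θ = omeg r θ ∧
    -- (4)
    (1 - h r ≤ omeg r θ ∧ omeg r θ ≤ 1 + h r) ∧
    (omeg r θ = 1 - h r ↔ Real.cos θ = -1) ∧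
    (omeg r θ = 1 + h r ↔ Real.cos θ = 1) ∧
    (0 < omeg r θ ∧ omeg r θ < 2) := by
  have hpos := h_pos hr hr1
  have hlt := h_lt_one hr hr1
  have hd := denom_pos hr hr1 θ
  have hleft := omeg_sub_one_sub_h hr hr1 θ
  have hright := one_add_h_sub_omeg hr hr1 θ
  have hA := div_pos (mul_pos hpos (alph_add_bet_pos hr hr1)) hd
  have hB := div_pos (mul_pos hpos (alph_sub_bet_pos hr hr1)) hd
  have hc : 0 ≤ 1 - Real.cos θ := sub_nonneg.mpr (Real.cos_le_one θ)
  have hc' : 0 ≤ 1 + Real.cos θ := by linarith [Real.neg_one_le_cos θ]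
  have hlower : 1 - h r ≤ omeg r θ := by
    linarith [mul_nonneg hA.le hc']
  have hupper : omeg r θ ≤ 1 + h r := by
    linarith [mul_nonneg hB.le hc]
  refine ⟨⟨hpos, hlt⟩, hd, omeg_one_div hr θ, ⟨hlower, hupper⟩, ?_, ?_,
    by linarith, by linarith⟩
  · rw [← sub_eq_zero, hleft, mul_eq_zero, or_iff_right hA.ne']
    constructor <;> intro <;> linarith
  · rw [eq_comm, ← sub_eq_zero, hright, mul_eq_zero, or_iff_right hB.ne']
    constructor <;> intro <;> linarith
end

section
/- For each fixed θ ∈ ℝ, ω(r,θ) → 3·(1 + cos θ)/(2 + cos θ) as r → 1 with r ≠ 1. Moreover, ω(r,θ) → 1 as r → 0⁺, uniformly in θ ∈ ℝ; that is, for every ε > 0 there exists r₀ > 0 such that |ω(r,θ) − 1| < ε for all 0 < r < r₀ and all θ ∈ ℝ. -/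
open Filter Topology

theorem h_eq_of_ne_one {r : ℝ} (hr : r ≠ 1) : h r = 2 * (r * Real.log r) / (r ^ 2 - 1) := by
  rw [h, if_neg hr, Real.log_pow]
  push_cast
  ring

theorem alph_eq (r : ℝ) : alph r = (r - 1) ^ 2 + 2 * r * (1 - h r) := by
  rw [alph]
  ring

theorem bet_eq (r : ℝ) : bet r = (r - 1) ^ 2 - (r ^ 2 + 1) * (1 - h r) := by
  rw [bet]
  ring

theorem tendsto_sub_one_sub_log_div_sq :
    Tendsto (fun r : ℝ => (2 * r - 2 * Real.log r - 2) / (3 * (r - 1) ^ 2)) (𝓝[≠] 1)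
      (𝓝 (1 / 3)) := by
  have hne : ∀ᶠ r : ℝ in 𝓝[≠] 1, r ≠ 1 := eventually_mem_nhdsWithin
  have hpos : ∀ᶠ r : ℝ in 𝓝[≠] 1, 0 < r :=
    (eventually_gt_nhds one_pos).filter_mono nhdsWithin_le_nhds
  refine HasDerivAt.lhopital_zero_nhdsNE (f' := fun r => 2 - 2 / r)
    (g' := fun r => 6 * (r - 1)) ?_ ?_ ?_ ?_ ?_ ?_
  · filter_upwards [hpos] with r hr
    convert! (((hasDerivAt_id r).const_mul 2).sub
      ((Real.hasDerivAt_log hr.ne').const_mul 2)).sub_const 2 using 1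
    ring
  · refine Eventually.of_forall fun r => ?_
    convert! ((((hasDerivAt_id r).sub_const 1).pow 2).const_mul 3) using 1
    simp
    ring
  · filter_upwards [hne] with r hr
    exact mul_ne_zero (by norm_num) (sub_ne_zero.mpr hr)
  · have : ContinuousAt (fun r : ℝ => 2 * r - 2 * Real.log r - 2) 1 := by
      fun_prop (disch := norm_num)
    simpa [ContinuousAt] using this.tendsto.mono_left nhdsWithin_le_nhds
  · have : ContinuousAt (fun r : ℝ => 3 * (r - 1) ^ 2) 1 := by fun_prop
    simpa [ContinuousAt] using this.tendsto.mono_left nhdsWithin_le_nhds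
  · have : ContinuousAt (fun r : ℝ => 1 / (3 * r)) 1 := by fun_prop (disch := norm_num)
    have hlim := this.tendsto.mono_left (nhdsWithin_le_nhds (s := {1}ᶜ))
    rw [mul_one] at hlim
    refine hlim.congr' ?_
    filter_upwards [hne, hpos] with r hr hr0
    have := sub_ne_zero.mpr hr
    field_simp
    ring

theorem tendsto_sq_sub_one_sub_mul_log_div_cube :
    Tendsto (fun r : ℝ => (r ^ 2 - 1 - 2 * (r * Real.log r)) / (r - 1) ^ 3) (𝓝[≠] 1)
      (𝓝 (1 / 3)) := by
  have hne : ∀ᶠ r : ℝ in 𝓝[≠] 1, r ≠ 1 := eventually_mem_nhdsWithin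
  have hpos : ∀ᶠ r : ℝ in 𝓝[≠] 1, 0 < r :=
    (eventually_gt_nhds one_pos).filter_mono nhdsWithin_le_nhds
  refine HasDerivAt.lhopital_zero_nhdsNE (f' := fun r => 2 * r - 2 * Real.log r - 2)
    (g' := fun r => 3 * (r - 1) ^ 2) ?_ ?_ ?_ ?_ ?_ tendsto_sub_one_sub_log_div_sq
  · filter_upwards [hpos] with r hr
    convert! (((hasDerivAt_id r).pow 2).sub_const 1).sub
      ((Real.hasDerivAt_mul_log hr.ne').const_mul 2) using 1
    simp
    ring
  · refine Eventually.of_forall fun r => ?_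
    convert! ((hasDerivAt_id r).sub_const 1).pow 3 using 1
    simp
  · filter_upwards [hne] with r hr
    exact mul_ne_zero (by norm_num) (pow_ne_zero _ (sub_ne_zero.mpr hr))
  · have : ContinuousAt (fun r : ℝ => r ^ 2 - 1 - 2 * (r * Real.log r)) 1 := by
      fun_prop (disch := norm_num)
    simpa [ContinuousAt] using this.tendsto.mono_left nhdsWithin_le_nhds
  · have : ContinuousAt (fun r : ℝ => (r - 1) ^ 3) 1 := by fun_prop
    simpa [ContinuousAt] using this.tendsto.mono_left nhdsWithin_le_nhds

theorem tendsto_one_sub_h_div_sq :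
    Tendsto (fun r : ℝ => (1 - h r) / (r - 1) ^ 2) (𝓝[≠] 1) (𝓝 (1 / 6)) := by
  have hne : ∀ᶠ r : ℝ in 𝓝[≠] 1, r ≠ 1 := eventually_mem_nhdsWithin
  have hpos : ∀ᶠ r : ℝ in 𝓝[≠] 1, 0 < r :=
    (eventually_gt_nhds one_pos).filter_mono nhdsWithin_le_nhds
  have hadd : Tendsto (fun r : ℝ => r + 1) (𝓝[≠] 1) (𝓝 (1 + 1)) :=
    (tendsto_nhdsWithin_of_tendsto_nhds tendsto_id).add_const 1
  have hlim := tendsto_sq_sub_one_sub_mul_log_div_cube.div hadd (by norm_num)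
  rw [show (1 / 3 / (1 + 1) : ℝ) = 1 / 6 by norm_num] at hlim
  refine hlim.congr' ?_
  filter_upwards [hne, hpos] with r hr hr0
  have h1 : r - 1 ≠ 0 := sub_ne_zero.mpr hr
  have h2 : r + 1 ≠ 0 := by positivity
  rw [Pi.div_apply, h_eq_of_ne_one hr, show r ^ 2 - 1 = (r - 1) * (r + 1) by ring]
  field_simp

theorem tendsto_alph_div_sq :
    Tendsto (fun r : ℝ => alph r / (r - 1) ^ 2) (𝓝[≠] 1) (𝓝 (4 / 3)) := by
  have hid : Tendsto (fun r : ℝ => r) (𝓝[≠] 1) (𝓝 1) :=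
    tendsto_nhdsWithin_of_tendsto_nhds tendsto_id
  have hlim := ((hid.const_mul 2).mul tendsto_one_sub_h_div_sq).const_add 1
  rw [show (1 + 2 * 1 * (1 / 6) : ℝ) = 4 / 3 by norm_num] at hlim
  refine hlim.congr' ?_
  filter_upwards [eventually_mem_nhdsWithin] with r hr
  have h1 : r - 1 ≠ 0 := sub_ne_zero.mpr hr
  rw [alph_eq]
  field_simp

theorem tendsto_bet_div_sq :
    Tendsto (fun r : ℝ => bet r / (r - 1) ^ 2) (𝓝[≠] 1) (𝓝 (2 / 3)) := by
  have hid : Tendsto (fun r : ℝ => r) (𝓝[≠] 1) (𝓝 1) :=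
    tendsto_nhdsWithin_of_tendsto_nhds tendsto_id
  have hlim := (((hid.pow 2).add_const 1).mul tendsto_one_sub_h_div_sq).const_sub 1
  rw [show (1 - (1 ^ 2 + 1) * (1 / 6) : ℝ) = 2 / 3 by norm_num] at hlim
  refine hlim.congr' ?_
  filter_upwards [eventually_mem_nhdsWithin] with r hr
  have h1 : r - 1 ≠ 0 := sub_ne_zero.mpr hr
  rw [bet_eq]
  field_simp

theorem tendsto_h_one : Tendsto h (𝓝[≠] 1) (𝓝 1) := by
  have hid : Tendsto (fun r : ℝ => r) (𝓝[≠] 1) (𝓝 1) :=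
    tendsto_nhdsWithin_of_tendsto_nhds tendsto_id
  have hlim := (((hid.sub_const 1).pow 2).mul tendsto_one_sub_h_div_sq).const_sub 1
  rw [show (1 - (1 - 1) ^ 2 * (1 / 6) : ℝ) = 1 by norm_num] at hlim
  refine hlim.congr' ?_
  filter_upwards [eventually_mem_nhdsWithin] with r hr
  have h1 : r - 1 ≠ 0 := sub_ne_zero.mpr hr
  field_simp
  ring

theorem tendsto_omeg_one (θ : ℝ) :
    Tendsto (fun r : ℝ => omeg r θ) (𝓝[≠] 1)
      (𝓝 (3 * (1 + Real.cos θ) / (2 + Real.cos θ))) := by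
  have hc : 2 + Real.cos θ ≠ 0 := by linarith [Real.neg_one_le_cos θ]
  have hnum := tendsto_h_one.mul
    ((tendsto_alph_div_sq.mul_const (Real.cos θ)).add tendsto_bet_div_sq)
  have hden := (tendsto_bet_div_sq.mul_const (Real.cos θ)).add tendsto_alph_div_sq
  have hlim := (hnum.div hden (by contrapose! hc; linarith)).const_add 1
  rw [show 1 + 1 * (4 / 3 * Real.cos θ + 2 / 3) / (2 / 3 * Real.cos θ + 4 / 3)
      = 3 * (1 + Real.cos θ) / (2 + Real.cos θ) by
    rw [show 2 / 3 * Real.cos θ + 4 / 3 = 2 / 3 * (2 + Real.cos θ) by ring]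
    field_simp
    ring] at hlim
  refine hlim.congr' ?_
  filter_upwards [eventually_mem_nhdsWithin] with r hr
  have h1 : (r - 1) ^ 2 ≠ 0 := pow_ne_zero _ (sub_ne_zero.mpr hr)
  simp only [Pi.div_apply, omeg]
  rw [div_mul_eq_mul_div, div_mul_eq_mul_div, ← add_div, ← add_div, ← mul_div_assoc,
    div_div_div_cancel_right₀ h1]

theorem tendsto_h_zero : Tendsto h (𝓝[>] 0) (𝓝 0) := by
  have hid : Tendsto (fun r : ℝ => r) (𝓝[>] 0) (𝓝 0) :=
    tendsto_nhdsWithin_of_tendsto_nhds tendsto_id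
  have hlog : Tendsto (fun r : ℝ => r * Real.log r) (𝓝[>] 0) (𝓝 0) := by
    simpa using (Real.continuous_mul_log.tendsto 0).mono_left nhdsWithin_le_nhds
  have hlim := (hlog.const_mul 2).div ((hid.pow 2).sub_const 1) (by norm_num)
  rw [show (2 * 0 / (0 ^ 2 - 1) : ℝ) = 0 by norm_num] at hlim
  refine hlim.congr' ?_
  filter_upwards [(eventually_ne_nhds zero_ne_one).filter_mono nhdsWithin_le_nhds] with r hr
  exact (h_eq_of_ne_one hr).symm

theorem tendsto_alph_zero : Tendsto alph (𝓝[>] 0) (𝓝 1) := by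
  have hid : Tendsto (fun r : ℝ => r) (𝓝[>] 0) (𝓝 0) :=
    tendsto_nhdsWithin_of_tendsto_nhds tendsto_id
  change Tendsto (fun r => r ^ 2 + 1 - 2 * r * h r) _ _
  simpa using ((hid.pow 2).add_const 1).sub ((hid.const_mul 2).mul tendsto_h_zero)

theorem tendsto_bet_zero : Tendsto bet (𝓝[>] 0) (𝓝 0) := by
  have hid : Tendsto (fun r : ℝ => r) (𝓝[>] 0) (𝓝 0) :=
    tendsto_nhdsWithin_of_tendsto_nhds tendsto_id
  change Tendsto (fun r => (r ^ 2 + 1) * h r - 2 * r) _ _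
  simpa using (((hid.pow 2).add_const 1).mul tendsto_h_zero).sub (hid.const_mul 2)

theorem abs_omeg_sub_one_le {r : ℝ} (hr : |bet r| < |alph r|) (θ : ℝ) :
    |omeg r θ - 1| ≤ |h r| * (|alph r| + |bet r|) / (|alph r| - |bet r|) := by
  have hmul (a : ℝ) : |a * Real.cos θ| ≤ |a| := by
    rw [abs_mul]
    exact mul_le_of_le_one_right (abs_nonneg a) (Real.abs_cos_le_one θ)
  rw [omeg, add_sub_cancel_left, abs_div, abs_mul]
  gcongr
  · exact (abs_add_le _ _).trans (add_le_add_left (hmul _) _)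
  · have := abs_add_le (bet r * Real.cos θ + alph r) (-(bet r * Real.cos θ))
    rw [abs_neg, add_neg_cancel_comm] at this
    linarith [hmul (bet r)]

theorem stmt17 (θ : ℝ) :
    -- ω(r,θ) → 3(1+cos θ)/(2+cos θ) as r → 1, r ≠ 1
    Filter.Tendsto (fun r : ℝ => omeg r θ) (nhdsWithin 1 {(1 : ℝ)}ᶜ)
      (nhds (3 * (1 + Real.cos θ) / (2 + Real.cos θ))) ∧
    -- ω(r,θ) → 1 as r → 0⁺, uniformly in θ
    (∀ ε : ℝ, 0 < ε → ∃ r0 : ℝ, 0 < r0 ∧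
      ∀ r : ℝ, 0 < r → r < r0 → ∀ θ' : ℝ, |omeg r θ' - 1| < ε) := by
  refine ⟨tendsto_omeg_one θ, fun ε hε => ?_⟩
  have ha := tendsto_alph_zero.abs
  have hb := tendsto_bet_zero.abs
  have hlim := (tendsto_h_zero.abs.mul (ha.add hb)).div (ha.sub hb) (by norm_num)
  have hlt : ∀ᶠ r in 𝓝[>] (0 : ℝ), |bet r| < |alph r| := hb.eventually_lt ha (by norm_num)
  have hev : ∀ᶠ r in 𝓝[>] (0 : ℝ), ∀ θ' : ℝ, |omeg r θ' - 1| < ε := by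
    filter_upwards [hlt, hlim.eventually_lt_const (by simpa using hε)] with r hr hrε θ'
    exact (abs_omeg_sub_one_le hr θ').trans_lt hrε
  obtain ⟨r0, hr0, hsub⟩ := mem_nhdsGT_iff_exists_Ioo_subset.mp hev
  exact ⟨r0, hr0, fun r h0 h1 => hsub ⟨h0, h1⟩⟩
end
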